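/- Let K be a field, Λ a τ-tilting finite finite-dimensional K-algebra, and 𝒯 a torsion class of finite-dimensional right Λ-modules. (1) If 𝒯 contains a nonzero projective Λ-module, then 𝒯 is not in the image of pop↓ : tors Λ → tors Λ. (2) If 𝒯⊥ contains a nonzero injective Λ-module, then 𝒯 is not in the image of pop↑ : tors Λ → tors Λ. -/

import Mathlib

namespace PaperTors

universe u

variable (K : Type u) [Field K] (Λ : Type u) [Ring Λ] [Algebra K Λ]

/-- The category of finite-dimensional right `Λ`-modules is modeled as bundled left modules over
the opposite algebra `Λᵐᵒᵖ` (a right `Λ`-module is the same thing as a left `Λᵐᵒᵖ`-module). -/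
abbrev RMod := ModuleCat.{u} Λᵐᵒᵖ

/-- `M` is finite-dimensional over `K` (with the `K`-action obtained through the algebra map
`K → Λᵐᵒᵖ`). -/
def IsFinDim (M : RMod Λ) : Prop :=
  letI : Module K M := Module.compHom M (algebraMap K Λᵐᵒᵖ)
  FiniteDimensional K M

/-- `𝒯` is a torsion class of finite-dimensional right `Λ`-modules: a class of modules, closed
under isomorphism, consisting of finite-dimensional modules, containing the zero module, and
closed under quotient modules and under extensions. -/
structure IsTorsionClass (𝒯 : Set (RMod Λ)) : Prop where
  iso_closed : ∀ M N : RMod Λ, (M ≃ₗ[Λᵐᵒᵖ] N) → M ∈ 𝒯 → N ∈ 𝒯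
  finDim : ∀ M ∈ 𝒯, IsFinDim K Λ M
  zero_mem : ∀ M : RMod Λ, Subsingleton M → M ∈ 𝒯
  quot_closed : ∀ (M N : RMod Λ) (f : M →ₗ[Λᵐᵒᵖ] N), Function.Surjective f → M ∈ 𝒯 → N ∈ 𝒯
  ext_closed : ∀ (M : RMod Λ) (A : Submodule Λᵐᵒᵖ M),
    ModuleCat.of Λᵐᵒᵖ A ∈ 𝒯 → ModuleCat.of Λᵐᵒᵖ (M ⧸ A) ∈ 𝒯 → M ∈ 𝒯

/-- The lattice of torsion classes `tors Λ`, ordered by inclusion. -/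
def TorsionClass : Type (u + 1) := {𝒯 : Set (RMod Λ) // IsTorsionClass K Λ 𝒯}

instance : PartialOrder (TorsionClass K Λ) := Subtype.partialOrder _

/-- `y` is the image of `x` under the pop-stack operator: `y` is the meet (the greatest lower
bound) of the set consisting of `x` together with all elements covered by `x`. -/
def IsPopDown {α : Type*} [PartialOrder α] (x y : α) : Prop :=
  IsGLB (insert x {z | z ⋖ x}) y

/-- `y` is the image of `x` under the dual pop-stack operator: `y` is the join (the least upper
bound) of the set consisting of `x` together with all elements covering `x`. -/
def IsPopUp {α : Type*} [PartialOrder α] (x y : α) : Prop :=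
  IsLUB (insert x {z | x ⋖ z}) y

variable {K}

/-- `W_L(𝒯)`: modules `M ∈ 𝒯` such that the kernel of any homomorphism from a module of `𝒯`
to `M` again lies in `𝒯`. -/
def WLower (𝒯 : Set (RMod Λ)) : Set (RMod Λ) :=
  {M | M ∈ 𝒯 ∧ ∀ N : RMod Λ, N ∈ 𝒯 → ∀ f : N →ₗ[Λᵐᵒᵖ] M,
    ModuleCat.of Λᵐᵒᵖ (LinearMap.ker f) ∈ 𝒯}

/-- `𝒟(𝒯)`: the nonzero modules of `W_L(𝒯)` having no proper nonzero submodule belonging to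
`W_L(𝒯)` (the brick labels of the cover relations below `𝒯`). -/
def DSet (𝒯 : Set (RMod Λ)) : Set (RMod Λ) :=
  {M | M ∈ WLower Λ 𝒯 ∧ (∃ m : M, m ≠ 0) ∧
    ∀ N : Submodule Λᵐᵒᵖ M, ModuleCat.of Λᵐᵒᵖ N ∈ WLower Λ 𝒯 → N = ⊥ ∨ N = ⊤}

/-- `𝒯⊥`: the modules admitting no nonzero homomorphism from any module of `𝒯`. -/
def Perp (𝒯 : Set (RMod Λ)) : Set (RMod Λ) :=
  {M | ∀ T : RMod Λ, T ∈ 𝒯 → ∀ f : T →ₗ[Λᵐᵒᵖ] M, f = 0}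

/-- `W_U(𝒯)`: modules `M ∈ 𝒯⊥` such that the cokernel of any homomorphism from `M` to a module
of `𝒯⊥` again lies in `𝒯⊥`. -/
def WUpper (𝒯 : Set (RMod Λ)) : Set (RMod Λ) :=
  {M | M ∈ Perp Λ 𝒯 ∧ ∀ N : RMod Λ, N ∈ Perp Λ 𝒯 → ∀ f : M →ₗ[Λᵐᵒᵖ] N,
    ModuleCat.of Λᵐᵒᵖ (N ⧸ LinearMap.range f) ∈ Perp Λ 𝒯}

/-- `𝒰(𝒯)`: the nonzero modules of `W_U(𝒯)` having no proper nonzero submodule belonging to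
`W_U(𝒯)` (the brick labels of the cover relations above `𝒯`). -/
def USet (𝒯 : Set (RMod Λ)) : Set (RMod Λ) :=
  {M | M ∈ WUpper Λ 𝒯 ∧ (∃ m : M, m ≠ 0) ∧
    ∀ N : Submodule Λᵐᵒᵖ M, ModuleCat.of Λᵐᵒᵖ N ∈ WUpper Λ 𝒯 → N = ⊥ ∨ N = ⊤}

/-- `Filt(𝒞)`: modules admitting a finite filtration by submodules whose successive quotients
are isomorphic to modules in `𝒞`. -/
def FiltSet (𝒞 : Set (RMod Λ)) : Set (RMod Λ) :=
  {M | ∃ (r : ℕ) (c : Fin (r + 1) → Submodule Λᵐᵒᵖ M), Monotone c ∧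
    c 0 = ⊥ ∧ c (Fin.last r) = ⊤ ∧
    ∀ i : Fin r, ∃ C ∈ 𝒞, Nonempty
      ((↥(c i.succ) ⧸ Submodule.comap (c i.succ).subtype (c i.castSucc)) ≃ₗ[Λᵐᵒᵖ] C)}


section Helpers

/-- An injective module contains a nonzero finitely generated retract. -/
theorem exists_fg_retract (K : Type u) [Field K] (A : Type u) [Ring A] [Algebra K A]
    [FiniteDimensional K A] (I : Type u) [AddCommGroup I] [Module A I] [Module K I]
    [IsScalarTower K A I] (hI : Module.Injective A I) (x : I) (hx : x ≠ 0) :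
    ∃ (M : Submodule A I) (ρ : I →ₗ[A] M), Module.Finite A M ∧ M ≠ ⊥ ∧ ∀ m : M, ρ m = m := by
  classical
  have : IsArtinianRing A := IsArtinianRing.of_finite K A
  have : IsNoetherianRing A := inferInstance
  let C : Submodule A I := Submodule.span A {x}
  have : Module.Finite A C := Module.Finite.span_singleton A x
  have : Module.Finite K C := Module.Finite.trans A C
  obtain ⟨p, hp⟩ := (C.restrictScalars K).subtype.exists_leftInverse_of_injective
    (by simp)
  have hp' : ∀ c (hc : c ∈ C), (p c : I) = c := by
    intro c hc
    have := LinearMap.congr_fun hp ⟨c, hc⟩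
    exact congrArg Subtype.val this
  have : Module.Finite K (C.restrictScalars K) := ‹Module.Finite K C›
  let Φ : I →ₗ[K] (A →ₗ[K] (C.restrictScalars K)) :=
    LinearMap.mk₂ K (fun y a => p (a • y)) (by simp) (by
      intro c y a; rw [smul_comm a c y]; simp) (by simp [add_smul]) (by simp)
  let Z : Submodule A I :=
    { carrier := {y | ∀ a : A, p (a • y) = 0}
      add_mem' := by intro y z hy hz a; simp [hy a, hz a]
      zero_mem' := by intro a; simp
      smul_mem' := by intro b y hy a; rw [smul_smul]; exact hy _ }
  have hZ : Z.restrictScalars K = LinearMap.ker Φ := by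
    ext y
    simp only [Submodule.restrictScalars_mem, LinearMap.mem_ker]
    constructor
    · intro h; ext a; exact congrArg Subtype.val (h a)
    · intro h a; exact LinearMap.congr_fun h a
  have h1 : Module.Finite K (I ⧸ Z.restrictScalars K) := by
    rw [hZ]
    exact Module.Finite.equiv (LinearMap.quotKerEquivRange Φ).symm
  have h2 : Module.Finite K (I ⧸ Z) :=
    Module.Finite.equiv (Submodule.Quotient.restrictScalarsEquiv K Z)
  have h3 : Module.Finite A (I ⧸ Z) := Module.Finite.of_restrictScalars_finite K A _
  have hinj : Function.Injective (Z.mkQ ∘ₗ C.subtype) := by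
    rw [← LinearMap.ker_eq_bot, LinearMap.ker_eq_bot']
    intro c hc
    have hc' : (c : I) ∈ Z := by simpa using hc
    have := hc' 1
    rw [one_smul] at this
    have h4 := hp' c c.2
    rw [this] at h4
    exact Subtype.ext h4.symm
  obtain ⟨g, hg⟩ := hI.out (Z.mkQ ∘ₗ C.subtype) hinj C.subtype
  let e : Module.End A I := g ∘ₗ Z.mkQ
  have hex : e x = x := hg ⟨x, Submodule.mem_span_singleton_self x⟩
  let W := LinearMap.range e
  have : Module.Finite A W := by
    have hWg : W ≤ LinearMap.range g := LinearMap.range_comp_le_range _ _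
    have : IsNoetherian A (LinearMap.range g) := inferInstance
    exact Module.Finite.of_injective (Submodule.inclusion hWg) (Submodule.inclusion_injective _)
  have hpow : ∀ m n, m ≤ n → LinearMap.range (e ^ n) ≤ LinearMap.range (e ^ m) := by
    intro m n h
    obtain ⟨k, rfl⟩ := Nat.exists_eq_add_of_le h
    rw [pow_add]
    exact LinearMap.range_comp_le_range _ _
  have hW : ∀ n, LinearMap.range (e ^ (n+1)) ≤ W := by
    intro n
    have := hpow 1 (n+1) (by omega)
    rwa [pow_one] at this
  obtain ⟨n, hn⟩ := IsArtinian.monotone_stabilizes (R := A) (M := W)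
    ⟨fun n => OrderDual.toDual (Submodule.comap W.subtype (LinearMap.range (e ^ (n+1)))), by
      intro a b h
      exact Submodule.comap_mono (hpow _ _ (by omega))⟩
  let M := LinearMap.range (e ^ (n+1))
  have hMf : Module.Finite A M :=
    Module.Finite.of_injective (Submodule.inclusion (hW n)) (Submodule.inclusion_injective _)
  have hM : M ≤ LinearMap.range (e ^ ((n+1) + (n+1))) := by
    intro y hy
    have h5 := hn (2*n+1) (by omega)
    have h6 : (⟨y, hW n hy⟩ : W) ∈ Submodule.comap W.subtype (LinearMap.range (e ^ (n+1))) := hy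
    have h7 : Submodule.comap W.subtype (LinearMap.range (e ^ (n+1))) =
      Submodule.comap W.subtype (LinearMap.range (e ^ (2*n+1+1))) := h5
    rw [h7] at h6
    have h8 : (n+1)+(n+1) = 2*n+1+1 := by omega
    rw [h8]
    exact h6
  let s : M →ₗ[A] M := (e ^ (n+1)).rangeRestrict ∘ₗ M.subtype
  have hs : Function.Surjective s := by
    rintro ⟨y, hy⟩
    obtain ⟨z, hz⟩ := hM hy
    refine ⟨⟨(e ^ (n+1)) z, ⟨z, rfl⟩⟩, Subtype.ext ?_⟩
    rw [pow_add] at hz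
    exact hz
  have hsi := IsNoetherian.injective_of_surjective_endomorphism s hs
  let S := LinearEquiv.ofBijective s ⟨hsi, hs⟩
  refine ⟨M, S.symm.toLinearMap ∘ₗ (e ^ (n+1)).rangeRestrict, hMf, ?_, ?_⟩
  · intro h
    have : x ∈ M := by
      refine ⟨x, ?_⟩
      have : ∀ k, (e ^ k) x = x := by
        intro k
        induction k with
        | zero => simp
        | succ k ih => rw [pow_succ, Module.End.mul_apply, hex, ih]
      exact this _
    rw [h] at this
    exact hx (by simpa using this)
  · intro m
    change S.symm (S m) = m
    simp

theorem isFinDim_iff (K : Type u) [Field K] (Λ : Type u) [Ring Λ] [Algebra K Λ]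
    [FiniteDimensional K Λ] (M : RMod Λ) : IsFinDim K Λ M ↔ Module.Finite Λᵐᵒᵖ M := by
  unfold IsFinDim
  let : Module K M := Module.compHom M (algebraMap K Λᵐᵒᵖ)
  have : IsScalarTower K Λᵐᵒᵖ M := IsScalarTower.of_algebraMap_smul (fun _ _ => rfl)
  constructor
  · intro h
    have : Module.Finite K M := h
    exact Module.Finite.of_restrictScalars_finite K Λᵐᵒᵖ M
  · intro h
    exact Module.Finite.trans Λᵐᵒᵖ M

variable {Λ}

theorem IsTorsionClass.ext' {𝒯 : Set (RMod Λ)} (h : IsTorsionClass K Λ 𝒯) (A M C : RMod Λ)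
    (i : A →ₗ[Λᵐᵒᵖ] M) (f : M →ₗ[Λᵐᵒᵖ] C) (hf : Function.Surjective f)
    (hif : LinearMap.ker f ≤ LinearMap.range i) (hif' : ∀ a, f (i a) = 0)
    (hA : A ∈ 𝒯) (hC : C ∈ 𝒯) : M ∈ 𝒯 := by
  refine h.ext_closed M (LinearMap.ker f) ?_ ?_
  · refine h.quot_closed A _ (i.codRestrict (LinearMap.ker f) hif') ?_ hA
    rintro ⟨y, hy⟩
    obtain ⟨a, ha⟩ := hif hy
    exact ⟨a, Subtype.ext ha⟩
  · exact h.iso_closed C _ (f.quotKerEquivOfSurjective hf).symm hC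

/-- The preimage in `P` of the image of a map from a torsion module to `P/R`, `R` torsion. -/
theorem IsTorsionClass.comap_mem {𝒯 : Set (RMod Λ)} (h : IsTorsionClass K Λ 𝒯) (P N : RMod Λ)
    (R : Submodule Λᵐᵒᵖ P) (f : N →ₗ[Λᵐᵒᵖ] (P ⧸ R)) (hR : ModuleCat.of Λᵐᵒᵖ R ∈ 𝒯) (hN : N ∈ 𝒯) :
    ModuleCat.of Λᵐᵒᵖ (Submodule.comap R.mkQ (LinearMap.range f)) ∈ 𝒯 := by
  have hle : R ≤ Submodule.comap R.mkQ (LinearMap.range f) := by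
    intro r hr
    have : R.mkQ r = 0 := by simpa using hr
    rw [Submodule.mem_comap, this]
    exact Submodule.zero_mem _
  refine h.ext' (ModuleCat.of Λᵐᵒᵖ R) (ModuleCat.of Λᵐᵒᵖ (Submodule.comap R.mkQ (LinearMap.range f)))
    (ModuleCat.of Λᵐᵒᵖ (LinearMap.range f))
    (Submodule.inclusion hle) (R.mkQ.restrict (fun x hx => hx)) ?_ ?_ ?_ hR
    (h.quot_closed N _ f.rangeRestrict f.surjective_rangeRestrict hN)
  · rintro ⟨y, hy⟩
    obtain ⟨z, rfl⟩ := R.mkQ_surjective y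
    exact ⟨⟨z, hy⟩, rfl⟩
  · rintro ⟨y, hy⟩ hy'
    have : R.mkQ y = 0 := congrArg Subtype.val hy'
    exact ⟨⟨y, by simpa using this⟩, rfl⟩
  · rintro ⟨r, hr⟩
    exact Subtype.ext (by simpa using hr)

/-- Modules without nonzero map to any module in `𝒢`, inside `𝒮`. -/
theorem torsion_inter {𝒯 : Set (RMod Λ)} (h : IsTorsionClass K Λ 𝒯) (𝒢 : Set (RMod Λ)) :
    IsTorsionClass K Λ {X | X ∈ 𝒯 ∧ ∀ G ∈ 𝒢, ∀ f : X →ₗ[Λᵐᵒᵖ] G, f = 0} := by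
  constructor
  · rintro M N e ⟨hM, hM'⟩
    refine ⟨h.iso_closed M N e hM, fun G hG f => ?_⟩
    have := hM' G hG (f ∘ₗ e.toLinearMap)
    ext x
    obtain ⟨y, rfl⟩ := e.surjective x
    exact LinearMap.congr_fun this y
  · exact fun M hM => h.finDim M hM.1
  · intro M hM
    refine ⟨h.zero_mem M hM, fun G hG f => ?_⟩
    ext x
    rw [Subsingleton.elim x 0]; simp
  · rintro M N e he ⟨hM, hM'⟩
    refine ⟨h.quot_closed M N e he hM, fun G hG f => ?_⟩
    have := hM' G hG (f ∘ₗ e)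
    ext x
    obtain ⟨y, rfl⟩ := he x
    exact LinearMap.congr_fun this y
  · rintro M A ⟨hA, hA'⟩ ⟨hB, hB'⟩
    refine ⟨h.ext_closed M A hA hB, fun G hG f => ?_⟩
    have h1 := hA' G hG (f ∘ₗ A.subtype)
    have h2 : A ≤ LinearMap.ker f := fun a ha => LinearMap.congr_fun h1 ⟨a, ha⟩
    have h3 := hB' G hG (A.liftQ f h2)
    ext x
    exact LinearMap.congr_fun h3 (A.mkQ x)

theorem torsion_all [FiniteDimensional K Λ] :
    IsTorsionClass K Λ {X : RMod Λ | Module.Finite Λᵐᵒᵖ X} := by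
  constructor
  · intro M N e (hM : Module.Finite _ _)
    exact Module.Finite.equiv e
  · intro M hM
    exact (isFinDim_iff K Λ M).2 hM
  · intro M hM
    exact (inferInstance : Module.Finite Λᵐᵒᵖ M)
  · intro M N f hf (hM : Module.Finite _ _)
    exact Module.Finite.of_surjective f hf
  · intro M A (hA : Module.Finite _ A) (hB : Module.Finite _ (M ⧸ A))
    exact Module.Finite.of_submodule_quotient A

theorem part_one [FiniteDimensional K Λ] (T T' : TorsionClass K Λ) (P : RMod Λ) (hP : P ∈ T.1)
    (hproj : Module.Projective Λᵐᵒᵖ P) (x : P) (hx : x ≠ 0) : ¬ IsPopDown T' T := by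
  intro hpop
  have : IsArtinianRing Λᵐᵒᵖ := IsArtinianRing.of_finite K Λᵐᵒᵖ
  have hP' : P ∈ T'.1 := hpop.1 (Set.mem_insert _ _) hP
  have h := T'.2
  have hfg : ∀ M ∈ T'.1, Module.Finite Λᵐᵒᵖ M := fun M hM =>
    (isFinDim_iff K Λ M).1 (h.finDim M hM)
  have := hfg P hP'
  obtain ⟨R, ⟨hR, hRT⟩, hmax⟩ := (wellFounded_gt (α := Submodule Λᵐᵒᵖ P)).has_min
    {R | R ≠ ⊤ ∧ ModuleCat.of Λᵐᵒᵖ R ∈ T'.1} ⟨⊥, by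
      intro hbot
      have : x ∈ (⊥ : Submodule Λᵐᵒᵖ P) := by rw [hbot]; trivial
      exact hx (by simpa using this), h.zero_mem _ (by
        change Subsingleton (⊥ : Submodule Λᵐᵒᵖ P)
        infer_instance)⟩
  let B : RMod Λ := ModuleCat.of Λᵐᵒᵖ (P ⧸ R)
  have key : ∀ N ∈ T'.1, ∀ f : N →ₗ[Λᵐᵒᵖ] (P ⧸ R), f ≠ 0 → Function.Surjective f := by
    intro N hN f hf0
    by_contra hns
    have hX := h.comap_mem P N R f hRT hN
    have hle : R ≤ Submodule.comap R.mkQ (LinearMap.range f) := by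
      intro r hr
      have : R.mkQ r = 0 := by simpa using hr
      rw [Submodule.mem_comap, this]
      exact Submodule.zero_mem _
    rcases hle.lt_or_eq with hlt | heq
    · refine hmax _ ⟨?_, hX⟩ hlt
      intro htop
      apply hns
      intro y
      obtain ⟨z, rfl⟩ := R.mkQ_surjective y
      have : z ∈ Submodule.comap R.mkQ (LinearMap.range f) := by rw [htop]; trivial
      exact this
    · apply hf0
      ext n
      obtain ⟨z, hz⟩ := R.mkQ_surjective (f n)
      have : z ∈ Submodule.comap R.mkQ (LinearMap.range f) := ⟨n, hz.symm⟩
      rw [← heq] at this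
      rw [← hz]
      simpa using this
  have hker : ∀ N ∈ T'.1, ∀ f : N →ₗ[Λᵐᵒᵖ] (P ⧸ R), Function.Surjective f →
      ModuleCat.of Λᵐᵒᵖ (LinearMap.ker f) ∈ T'.1 := by
    intro N hN f hf
    obtain ⟨g, hg⟩ := Module.projective_lifting_property f R.mkQ hf
    have hg' : ∀ p, f (g p) = R.mkQ p := fun p => LinearMap.congr_fun hg p
    let E : Submodule Λᵐᵒᵖ (N × P) :=
      LinearMap.ker (f ∘ₗ LinearMap.fst _ _ _ - R.mkQ ∘ₗ LinearMap.snd _ _ _)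
    have hE : ∀ z : N × P, z ∈ E ↔ f z.1 = R.mkQ z.2 := by
      intro z
      simp [E, sub_eq_zero]
    have hET : ModuleCat.of Λᵐᵒᵖ E ∈ T'.1 := by
      refine h.ext' (ModuleCat.of Λᵐᵒᵖ R) (ModuleCat.of Λᵐᵒᵖ E) N
        (LinearMap.codRestrict E (LinearMap.inr _ _ _ ∘ₗ R.subtype) ?_)
        (LinearMap.fst _ _ _ ∘ₗ E.subtype) ?_ ?_ ?_ hRT hN
      · intro r
        rw [hE]
        have h1 : R.mkQ (r : P) = 0 := by
          rw [Submodule.mkQ_apply, Submodule.Quotient.mk_eq_zero]; exact r.2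
        exact (map_zero f).trans h1.symm
      · intro n
        obtain ⟨p, hp⟩ := R.mkQ_surjective (f n)
        exact ⟨⟨(n, p), (hE _).2 hp.symm⟩, rfl⟩
      · rintro ⟨⟨n, p⟩, hz⟩ hz'
        have hn : n = 0 := hz'
        subst hn
        have := (hE _).1 hz
        have hp : p ∈ R := by
          rw [map_zero] at this
          simpa using this.symm
        exact ⟨⟨p, hp⟩, rfl⟩
      · intro r; rfl
    refine h.quot_closed (ModuleCat.of Λᵐᵒᵖ E) _ (LinearMap.codRestrict (LinearMap.ker f)
      ((LinearMap.fst _ _ _ - g ∘ₗ LinearMap.snd _ _ _) ∘ₗ E.subtype) ?_) ?_ hET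
    · rintro ⟨z, hz⟩
      have := (hE _).1 hz
      simp [hg', this]
    · rintro ⟨n, hn⟩
      refine ⟨⟨(n, 0), (hE _).2 (by simpa using hn)⟩, Subtype.ext ?_⟩
      simp
  let U : TorsionClass K Λ := ⟨_, torsion_inter h {B}⟩
  have hPU : P ∉ U.1 := by
    intro hPU
    have h1 : R.mkQ = 0 := hPU.2 B rfl R.mkQ
    apply hR
    rw [← R.ker_mkQ, h1, LinearMap.ker_zero]
  have hUT : U ≤ T' := fun X hX => hX.1
  have hcov : U ⋖ T' := by
    refine ⟨lt_of_le_of_ne hUT ?_, ?_⟩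
    · intro he
      rw [he] at hPU
      exact hPU hP'
    · intro V hUV hVT
      apply hVT.not_ge
      have hBV : B ∈ V.1 := by
        obtain ⟨N, hNV, hNU⟩ := Set.not_subset.1 hUV.not_ge
        have hN : N ∈ T'.1 := hVT.le hNV
        have : ∃ f : N →ₗ[Λᵐᵒᵖ] (P ⧸ R), f ≠ 0 := by
          by_contra! hall
          exact hNU ⟨hN, by rintro G rfl f; exact hall f⟩
        obtain ⟨f, hf⟩ := this
        exact V.2.quot_closed N B f (key N hN f hf) hNV
      intro N hN
      have := hfg N hN
      suffices hmain : ∀ Y : Submodule Λᵐᵒᵖ N, ModuleCat.of Λᵐᵒᵖ Y ∈ T'.1 →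
          ModuleCat.of Λᵐᵒᵖ Y ∈ V.1 by
        have e : (⊤ : Submodule Λᵐᵒᵖ N) ≃ₗ[Λᵐᵒᵖ] N := Submodule.topEquiv
        exact V.2.iso_closed _ _ e (hmain ⊤ (T'.2.iso_closed _ _ e.symm hN))
      intro Y
      induction Y using WellFoundedLT.induction with
      | ind Y ih =>
      intro hY
      by_cases hall : ∀ f : Y →ₗ[Λᵐᵒᵖ] (P ⧸ R), f = 0
      · exact hUV.le ⟨hY, by rintro G rfl f; exact hall f⟩
      · push Not at hall
        obtain ⟨f, hf⟩ := hall
        have hs := key _ hY f hf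
        have hk := hker _ hY f hs
        have e := Submodule.equivSubtypeMap Y (LinearMap.ker f)
        have hkT := T'.2.iso_closed _ (ModuleCat.of Λᵐᵒᵖ (Submodule.map Y.subtype (LinearMap.ker f)))
          e hk
        have hlt : Submodule.map Y.subtype (LinearMap.ker f) < Y := by
          refine lt_of_le_of_ne (Submodule.map_subtype_le _ _) ?_
          intro heq
          apply hf
          ext y
          have hy : (y : N) ∈ Submodule.map Y.subtype (LinearMap.ker f) := by
            rw [heq]; exact y.2
          obtain ⟨z, hz, hzy⟩ := hy
          have : z = y := Subtype.ext hzy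
          rw [← this]
          exact hz
        have h9 := V.2.iso_closed _ (ModuleCat.of Λᵐᵒᵖ (LinearMap.ker f)) e.symm (ih _ hlt hkT)
        refine V.2.ext' _ (ModuleCat.of Λᵐᵒᵖ Y) B (LinearMap.ker f).subtype f hs ?_ ?_ h9 hBV
        · simp
        · intro a; exact a.2
  exact hPU (hpop.1 (Set.mem_insert_of_mem _ hcov) hP)

/-- Torsion classes are determined by finitely generated torsion-free modules. -/
theorem mem_of_perp [FiniteDimensional K Λ] (V : TorsionClass K Λ) (X : RMod Λ)
    (hX : Module.Finite Λᵐᵒᵖ X)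
    (hp : ∀ N ∈ Perp Λ V.1, Module.Finite Λᵐᵒᵖ N → ∀ f : X →ₗ[Λᵐᵒᵖ] N, f = 0) : X ∈ V.1 := by
  have : IsArtinianRing Λᵐᵒᵖ := IsArtinianRing.of_finite K Λᵐᵒᵖ
  have h := V.2
  obtain ⟨R, hRT, hmax⟩ := (wellFounded_gt (α := Submodule Λᵐᵒᵖ X)).has_min
    {R | ModuleCat.of Λᵐᵒᵖ R ∈ V.1} ⟨⊥, h.zero_mem _ (by
        change Subsingleton (⊥ : Submodule Λᵐᵒᵖ X)
        infer_instance)⟩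
  have hperp : ModuleCat.of Λᵐᵒᵖ (X ⧸ R) ∈ Perp Λ V.1 := by
    intro N hN f
    change N →ₗ[Λᵐᵒᵖ] (X ⧸ R) at f
    have hX := h.comap_mem X N R f hRT hN
    have hle : R ≤ Submodule.comap R.mkQ (LinearMap.range f) := by
      intro r hr
      have : R.mkQ r = 0 := by simpa using hr
      rw [Submodule.mem_comap, this]
      exact Submodule.zero_mem _
    rcases hle.lt_or_eq with hlt | heq
    · exact absurd hlt (hmax _ hX)
    · ext n
      obtain ⟨z, hz⟩ := R.mkQ_surjective (f n)
      have : z ∈ Submodule.comap R.mkQ (LinearMap.range f) := ⟨n, hz.symm⟩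
      rw [← heq] at this
      rw [← hz]
      simpa using this
  have h0 : R.mkQ = 0 := hp _ hperp (inferInstanceAs (Module.Finite Λᵐᵒᵖ (X ⧸ R))) R.mkQ
  have htop : R = ⊤ := by rw [← R.ker_mkQ, h0, LinearMap.ker_zero]
  subst htop
  exact h.iso_closed _ _ Submodule.topEquiv hRT

theorem perp_sub {𝒯 : Set (RMod Λ)} (M N : RMod Λ) (i : M →ₗ[Λᵐᵒᵖ] N)
    (hi : Function.Injective i) (hN : N ∈ Perp Λ 𝒯) : M ∈ Perp Λ 𝒯 := by
  intro T hT f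
  have := hN T hT (i ∘ₗ f)
  ext t
  apply hi
  simpa using LinearMap.congr_fun this t

theorem perp_ext {𝒯 : Set (RMod Λ)} (A M C : RMod Λ) (i : A →ₗ[Λᵐᵒᵖ] M)
    (g : M →ₗ[Λᵐᵒᵖ] C) (hi : Function.Injective i) (hk : LinearMap.ker g ≤ LinearMap.range i)
    (hA : A ∈ Perp Λ 𝒯) (hC : C ∈ Perp Λ 𝒯) : M ∈ Perp Λ 𝒯 := by
  intro T hT f
  have h1 := hC T hT (g ∘ₗ f)
  have h2 : ∀ t, f t ∈ LinearMap.range i := fun t => hk (LinearMap.congr_fun h1 t)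
  let e := LinearEquiv.ofInjective i hi
  have h3 := hA T hT (e.symm.toLinearMap ∘ₗ f.codRestrict _ h2)
  ext t
  have h4 : e.symm (f.codRestrict _ h2 t) = 0 := LinearMap.congr_fun h3 t
  rw [e.symm.map_eq_zero_iff] at h4
  exact congrArg Subtype.val h4

theorem part_two [FiniteDimensional K Λ] (T T' : TorsionClass K Λ) (I : RMod Λ)
    (hIp : I ∈ Perp Λ T.1)
    (hinj : Module.Injective Λᵐᵒᵖ I) (x : I) (hx : x ≠ 0) : ¬ IsPopUp T' T := by
  intro hpop
  have : IsArtinianRing Λᵐᵒᵖ := IsArtinianRing.of_finite K Λᵐᵒᵖ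
  have hanti : ∀ {V W : TorsionClass K Λ}, V ≤ W → Perp Λ W.1 ⊆ Perp Λ V.1 :=
    fun hVW N hN X hX f => hN X (hVW hX) f
  have hIp' : I ∈ Perp Λ T'.1 := hanti (hpop.1 (Set.mem_insert _ _)) hIp
  obtain ⟨M, ρ, hMf, hM0, hρ⟩ : ∃ (M : Submodule Λᵐᵒᵖ I) (ρ : I →ₗ[Λᵐᵒᵖ] M),
      Module.Finite Λᵐᵒᵖ M ∧ M ≠ ⊥ ∧ ∀ m : M, ρ m = m := by
    let : Module K I := Module.compHom I (algebraMap K Λᵐᵒᵖ)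
    have : IsScalarTower K Λᵐᵒᵖ I := IsScalarTower.of_algebraMap_smul (fun _ _ => rfl)
    exact exists_fg_retract K Λᵐᵒᵖ I hinj x hx
  obtain ⟨L, ⟨hL0, hLF⟩, hmin⟩ := (wellFounded_lt (α := Submodule Λᵐᵒᵖ M)).has_min
    {L | L ≠ ⊥ ∧ ModuleCat.of Λᵐᵒᵖ (M ⧸ L) ∈ Perp Λ T'.1} ⟨⊤, by
      intro htop
      apply hM0
      rw [Submodule.eq_bot_iff]
      intro m hm
      have : (⟨m, hm⟩ : M) ∈ (⊥ : Submodule Λᵐᵒᵖ M) := by rw [← htop]; trivial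
      exact congrArg Subtype.val ((Submodule.mem_bot _).1 this), by
      intro X hX f
      change X →ₗ[Λᵐᵒᵖ] (M ⧸ (⊤ : Submodule Λᵐᵒᵖ M)) at f
      ext t
      exact Subsingleton.elim (α := M ⧸ (⊤ : Submodule Λᵐᵒᵖ M)) _ _⟩
  let LL : RMod Λ := ModuleCat.of Λᵐᵒᵖ L
  let i : L →ₗ[Λᵐᵒᵖ] I := M.subtype ∘ₗ L.subtype
  have hi : Function.Injective i := M.injective_subtype.comp L.injective_subtype
  have hLperp : LL ∈ Perp Λ T'.1 := perp_sub LL I i hi hIp'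
  -- nonzero maps out of `L` are injective
  have key : ∀ N ∈ Perp Λ T'.1, ∀ φ : L →ₗ[Λᵐᵒᵖ] N, φ ≠ 0 → Function.Injective φ := by
    intro N hN φ hφ
    by_contra hni
    rw [← LinearMap.ker_eq_bot] at hni
    have hlt : Submodule.map L.subtype (LinearMap.ker φ) < L := by
      refine lt_of_le_of_ne (Submodule.map_subtype_le _ _) ?_
      intro heq
      apply hφ
      ext y
      have hy : (y : M) ∈ Submodule.map L.subtype (LinearMap.ker φ) := by
        rw [heq]; exact y.2
      obtain ⟨z, hz, hzy⟩ := hy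
      have : z = y := Subtype.ext hzy
      rw [← this]
      exact hz
    refine hmin _ ⟨?_, ?_⟩ hlt
    · intro h0
      apply hni
      exact Submodule.map_injective_of_injective L.injective_subtype (h0.trans (Submodule.map_bot _).symm)
    · set k := Submodule.map L.subtype (LinearMap.ker φ) with hk
      have hker : LinearMap.ker φ ≤ Submodule.comap L.subtype k := Submodule.le_comap_map _ _
      refine perp_ext (ModuleCat.of Λᵐᵒᵖ (L ⧸ LinearMap.ker φ)) (ModuleCat.of Λᵐᵒᵖ (M ⧸ k))
        (ModuleCat.of Λᵐᵒᵖ (M ⧸ L)) (Submodule.mapQ _ k L.subtype hker)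
        (Submodule.factor hlt.le) ?_ ?_ ?_ hLF
      · rw [← LinearMap.ker_eq_bot, LinearMap.ker_eq_bot']
        intro y hy
        change L ⧸ LinearMap.ker φ at y
        obtain ⟨l, rfl⟩ := Submodule.mkQ_surjective _ y
        have h1 : (l : M) ∈ k := by simpa using hy
        obtain ⟨z, hz, hzy⟩ := h1
        have : z = l := Subtype.ext hzy
        rw [← this]
        simpa using hz
      · intro y hy
        change M ⧸ k at y
        obtain ⟨m, rfl⟩ := Submodule.mkQ_surjective _ y
        have h1 : m ∈ L := by simpa using hy
        exact ⟨Submodule.Quotient.mk ⟨m, h1⟩, rfl⟩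
      · refine perp_sub _ N ((LinearMap.ker φ).liftQ φ le_rfl) ?_ hN
        rw [← LinearMap.ker_eq_bot]
        exact Submodule.ker_liftQ_eq_bot _ _ _ le_rfl
  -- cokernels are torsion-free
  have hcok : ∀ N ∈ Perp Λ T'.1, ∀ φ : L →ₗ[Λᵐᵒᵖ] N, Function.Injective φ →
      ModuleCat.of Λᵐᵒᵖ (N ⧸ LinearMap.range φ) ∈ Perp Λ T'.1 := by
    intro N hN φ hφ
    obtain ⟨ψ₀, hψ₀⟩ := hinj.out φ hφ i
    let ψ : N →ₗ[Λᵐᵒᵖ] M := ρ ∘ₗ ψ₀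
    have hψ : ∀ l : L, ψ (φ l) = l := by
      intro l
      change ρ (ψ₀ (φ l)) = l
      rw [hψ₀]
      exact hρ l
    have hle : LinearMap.range φ ≤ Submodule.comap ψ L := by
      rintro _ ⟨l, rfl⟩
      simp only [Submodule.mem_comap, hψ]
      exact l.2
    refine perp_ext (ModuleCat.of Λᵐᵒᵖ (LinearMap.ker ψ))
      (ModuleCat.of Λᵐᵒᵖ (N ⧸ LinearMap.range φ)) (ModuleCat.of Λᵐᵒᵖ (M ⧸ L))
      ((LinearMap.range φ).mkQ ∘ₗ (LinearMap.ker ψ).subtype)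
      (Submodule.mapQ _ _ ψ hle) ?_ ?_ ?_ hLF
    · rw [← LinearMap.ker_eq_bot, LinearMap.ker_eq_bot']
      rintro ⟨n, hn⟩ hn'
      have h1 : n ∈ LinearMap.range φ := by simpa using hn'
      obtain ⟨l, rfl⟩ := h1
      have h2 : ψ (φ l) = 0 := hn
      rw [hψ] at h2
      have h3 : l = 0 := Subtype.ext h2
      exact Subtype.ext (by simp [h3])
    · intro y hy
      change N ⧸ LinearMap.range φ at y
      obtain ⟨n, rfl⟩ := Submodule.mkQ_surjective _ y
      have h1 : ψ n ∈ L := by simpa using hy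
      refine ⟨⟨n - φ ⟨ψ n, h1⟩, ?_⟩, ?_⟩
      · simp [hψ]
      · change (LinearMap.range φ).mkQ (n - φ ⟨ψ n, h1⟩) = (LinearMap.range φ).mkQ n
        rw [map_sub, sub_eq_self]
        simp
    · exact perp_sub _ N (LinearMap.ker ψ).subtype (Submodule.injective_subtype _) hN
  let 𝒢 : Set (RMod Λ) := {N | N ∈ Perp Λ T'.1 ∧ ∀ φ : L →ₗ[Λᵐᵒᵖ] N, φ = 0}
  let U : TorsionClass K Λ := ⟨_, torsion_inter torsion_all 𝒢⟩
  have hfg : ∀ (V : TorsionClass K Λ), ∀ X ∈ V.1, Module.Finite Λᵐᵒᵖ X := fun V X hX =>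
    (isFinDim_iff K Λ X).1 (V.2.finDim X hX)
  have hLU : LL ∈ U.1 :=
    ⟨inferInstanceAs (Module.Finite Λᵐᵒᵖ L), fun G hG f => hG.2 f⟩
  have hTU : T' ≤ U := fun X hX => ⟨hfg _ X hX, fun G hG f => hG.1 X hX f⟩
  have hcov : T' ⋖ U := by
    refine ⟨lt_of_le_of_ne hTU ?_, ?_⟩
    · intro he
      have h1 : LL ∈ T'.1 := by rw [he]; exact hLU
      have h2 : (LinearMap.id : L →ₗ[Λᵐᵒᵖ] L) = 0 := hLperp LL h1 LinearMap.id
      apply hL0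
      rw [Submodule.eq_bot_iff]
      intro m hm
      exact congrArg Subtype.val (LinearMap.congr_fun h2 ⟨m, hm⟩)
    · intro V hTV hVU
      apply hVU.not_ge
      have hGV : ∀ N ∈ 𝒢, N ∈ Perp Λ V.1 := fun N hN X hX f => (hVU.le hX).2 N hN f
      intro X hX
      apply mem_of_perp V X hX.1
      intro N hN hNf
      apply hX.2
      refine ⟨hanti hTV.le hN, ?_⟩
      by_contra! hφ
      obtain ⟨φ, hφ⟩ := hφ
      have hφi := key N (hanti hTV.le hN) φ hφ
      have hLV : LL ∈ Perp Λ V.1 := perp_sub LL N φ hφi hN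
      apply hTV.not_ge
      intro Y hY
      apply mem_of_perp T' Y (hfg V Y hY)
      intro Q hQ hQf
      suffices hmain : ∀ (S : Submodule Λᵐᵒᵖ Q) (Q' : RMod Λ) (π : Q →ₗ[Λᵐᵒᵖ] Q'),
          Function.Surjective π → LinearMap.ker π = S → Q' ∈ Perp Λ T'.1 → Q' ∈ Perp Λ V.1 from
        hmain _ Q LinearMap.id Function.surjective_id rfl hQ Y hY
      intro S
      induction S using WellFoundedGT.induction with
      | ind S ih =>
      intro Q' π hπ hS hQ'
      by_cases hall : ∀ φ : L →ₗ[Λᵐᵒᵖ] Q', φ = 0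
      · exact hGV Q' ⟨hQ', hall⟩
      · push Not at hall
        obtain ⟨φ, hφ⟩ := hall
        have hφi := key Q' hQ' φ hφ
        have hc := hcok Q' hQ' φ hφi
        refine perp_ext LL Q' (ModuleCat.of Λᵐᵒᵖ (Q' ⧸ LinearMap.range φ)) φ
          (LinearMap.range φ).mkQ hφi (by simp) hLV ?_
        refine ih (Submodule.comap π (LinearMap.range φ)) ?_
          (ModuleCat.of Λᵐᵒᵖ (Q' ⧸ LinearMap.range φ)) ((LinearMap.range φ).mkQ ∘ₗ π)
          ((Submodule.mkQ_surjective _).comp hπ) (by rw [LinearMap.ker_comp, Submodule.ker_mkQ]) hc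
        rw [← hS]
        refine lt_of_le_of_ne ?_ ?_
        · intro z hz
          rw [LinearMap.mem_ker] at hz
          simp [Submodule.mem_comap, hz]
        · intro heq
          apply hφ
          ext l
          obtain ⟨z, hz⟩ := hπ (φ l)
          have h1 : z ∈ Submodule.comap π (LinearMap.range φ) := ⟨l, hz.symm⟩
          rw [← heq] at h1
          rw [← hz]
          exact h1
  have h1 : U ≤ T := hpop.1 (Set.mem_insert_of_mem _ hcov)
  have h2 : i = 0 := hIp LL (h1 hLU) i
  apply hL0
  rw [Submodule.eq_bot_iff]
  intro m hm
  have h3 : i ⟨m, hm⟩ = 0 := by rw [h2]; rfl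
  have h4 : (⟨m, hm⟩ : L) = 0 := hi (by rw [h3, map_zero])
  exact congrArg Subtype.val h4

end Helpers

/-- Let `Λ` be a τ-tilting finite finite-dimensional `K`-algebra and `𝒯` a
torsion class.  (1) If `𝒯` contains a nonzero projective module, then `𝒯` is not in the image
of `pop↓`.  (2) If `𝒯⊥` contains a nonzero injective module, then `𝒯` is not in the image of
`pop↑`. -/
theorem stmt3 [FiniteDimensional K Λ] (hfin : Finite (TorsionClass K Λ))
    (T : TorsionClass K Λ) :
    ((∃ P ∈ T.1, Module.Projective Λᵐᵒᵖ P ∧ ∃ x : P, x ≠ 0) →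
      ¬ ∃ T' : TorsionClass K Λ, IsPopDown T' T) ∧
    ((∃ I ∈ Perp Λ T.1, Module.Injective Λᵐᵒᵖ I ∧ ∃ x : I, x ≠ 0) →
      ¬ ∃ T' : TorsionClass K Λ, IsPopUp T' T) := by
  refine ⟨?_, ?_⟩
  · rintro ⟨P, hP, hproj, x, hx⟩ ⟨T', hT'⟩
    exact part_one T T' P hP hproj x hx hT'
  · rintro ⟨I, hI, hinj, x, hx⟩ ⟨T', hT'⟩
    exact part_two T T' I hI hinj x hx hT'

end PaperTors
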